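/- Let B be an invariant symmetric bilinear form on g, let h ∈ g, and let P, Q : g → g be continuous maps satisfying [P(u), u] = 0 and [Q(u), u] = 0 for all u ∈ g. Then for all x ∈ g and all s, t ∈ ℂ: B(x, [P(x + t•h), Q(x + s•h)]) = 0. (This expresses that the shifted functions x ↦ φ(x+th), for φ invariant, are pairwise in involution with respect to the Lie–Poisson bracket.) -/

import Mathlib

/-- If `p` commutes with `u`, then `u` is orthogonal to every bracket `[p, q]`. -/
theorem invariantForm_lie_eq_zero {R g : Type*} [CommRing R] [AddCommGroup g] [Module R g]
    {lie : g →ₗ[R] g →ₗ[R] g} {B : g →ₗ[R] g →ₗ[R] R}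
    (hBinv : ∀ x y z : g, B (lie z x) y + B x (lie z y) = 0)
    {p u : g} (hpu : lie p u = 0) (q : g) : B u (lie p q) = 0 := by
  simpa [hpu] using hBinv u q p

theorem stmt {g : Type*} [NormedAddCommGroup g] [NormedSpace ℂ g] [FiniteDimensional ℂ g]
    -- `lie` is the Lie bracket of the finite-dimensional complex Lie algebra `g`,
    -- given as bilinear data so that it is compatible with the normed space structure.
    (lie : g →ₗ[ℂ] g →ₗ[ℂ] g)
    (lie_self : ∀ x : g, lie x x = 0)
    (lie_jacobi : ∀ x y z : g, lie x (lie y z) = lie (lie x y) z + lie y (lie x z))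
    (B : g →ₗ[ℂ] g →ₗ[ℂ] ℂ)
    (hBsymm : ∀ x y : g, B x y = B y x)
    (hBinv : ∀ x y z : g, B (lie z x) y + B x (lie z y) = 0)
    (h : g) (P Q : g → g) (hPc : Continuous P) (hQc : Continuous Q)
    (hPcomm : ∀ u : g, lie (P u) u = 0)
    (hQcomm : ∀ u : g, lie (Q u) u = 0)
    (x : g) (s t : ℂ) :
    B x (lie (P (x + t • h)) (Q (x + s • h))) = 0 := by
  have lie_skew : ∀ a b : g, lie a b = -lie b a := fun a b ↦ by
    have hab := lie_self (a + b)
    simp only [map_add, LinearMap.add_apply, lie_self, zero_add, add_zero] at hab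
    exact eq_neg_of_add_eq_zero_right hab
  have of_ne : ∀ r ∈ ({t}ᶜ : Set ℂ), B x (lie (P (x + t • h)) (Q (x + r • h))) = 0 := by
    intro r hr
    have hp := invariantForm_lie_eq_zero hBinv (hPcomm (x + t • h)) (Q (x + r • h))
    have hq := invariantForm_lie_eq_zero hBinv (hQcomm (x + r • h)) (P (x + t • h))
    rw [lie_skew, map_neg, neg_eq_zero] at hq
    simp only [map_add, map_smul, LinearMap.add_apply, LinearMap.smul_apply, smul_eq_mul] at hp hq
    refine (mul_eq_zero.mp ?_).resolve_left (sub_ne_zero.mpr hr)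
    linear_combination r * hp - t * hq
  have hcont : Continuous fun r : ℂ ↦ B x (lie (P (x + t • h)) (Q (x + r • h))) :=
    ((B x).comp (lie (P (x + t • h)))).continuous_of_finiteDimensional.comp
      (hQc.comp (by fun_prop))
  -- The case `s = t` follows by continuity, since `{t}ᶜ` is dense.
  exact congrFun (hcont.ext_on (dense_compl_singleton t) continuous_const of_ne) s
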